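/- arXiv:math/0508347 — 9 statements merged into one kernel-verified Lean document; each statement's English description precedes it below -/
import Mathlib

section
/- Let Θ : 𝔻 → M₂(ℂ) be any function on the open unit disc. Then there exist rank-one orthogonal projections Q₁, Q₂ on ℂ² satisfying Θ(λ)Q₂ = Q₁Θ(λ) for all λ ∈ 𝔻 if and only if there exist unitary matrices W₁, W₂ ∈ M₂(ℂ) and functions θ₁, θ₂ : 𝔻 → ℂ such that W₁Θ(λ)W₂ = [[θ₁(λ), 0], [0, θ₂(λ)]] for all λ ∈ 𝔻. -/
open Metric

/-- `Q` is a rank-one orthogonal projection on `ℂ²`. -/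
def IsRankOneProj (Q : Matrix (Fin 2) (Fin 2) ℂ) : Prop :=
  Q.conjTranspose = Q ∧ Q * Q = Q ∧ Q.rank = 1

lemma unit_conj_proj (U E : Matrix (Fin 2) (Fin 2) ℂ) (h1 : U.conjTranspose * U = 1)
    (h2 : U * U.conjTranspose = 1) (hE : E = !![1, 0; 0, 0]) :
    IsRankOneProj (U * E * U.conjTranspose) := by
  have hEs : E.conjTranspose = E := by
    subst hE; ext i j; fin_cases i <;> fin_cases j <;> simp
  have hEE : E * E = E := by
    subst hE; ext i j; fin_cases i <;> fin_cases j <;> simp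
  have hr : E.rank = 1 := by
    have : E = Matrix.diagonal ![1, 0] := by
      subst hE; ext i j; fin_cases i <;> fin_cases j <;> simp
    rw [this, Matrix.rank_diagonal, Fintype.card_eq_one_iff]
    refine ⟨⟨0, by simp⟩, ?_⟩
    rintro ⟨i, hi⟩
    fin_cases i
    · rfl
    · exact absurd rfl hi
  refine ⟨?_, ?_, ?_⟩
  · simp [Matrix.conjTranspose_mul, hEs, Matrix.mul_assoc]
  · calc U * E * U.conjTranspose * (U * E * U.conjTranspose)
        = U * E * (U.conjTranspose * U) * E * U.conjTranspose := by simp only [Matrix.mul_assoc]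
      _ = U * (E * E) * U.conjTranspose := by rw [h1]; simp only [Matrix.mul_assoc, Matrix.one_mul]
      _ = _ := by rw [hEE]
  · have u1 : IsUnit U.det := by
      rw [← Matrix.isUnit_iff_isUnit_det]; exact ⟨⟨U, _, h2, h1⟩, rfl⟩
    have u2 : IsUnit U.conjTranspose.det := by
      rw [← Matrix.isUnit_iff_isUnit_det]; exact ⟨⟨_, U, h1, h2⟩, rfl⟩
    rw [Matrix.rank_mul_eq_left_of_isUnit_det _ _ u2, Matrix.rank_mul_eq_right_of_isUnit_det _ _ u1, hr]

lemma exists_unit_conj (Q : Matrix (Fin 2) (Fin 2) ℂ) (hQ : IsRankOneProj Q) :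
    ∃ U : Matrix (Fin 2) (Fin 2) ℂ, U.conjTranspose * U = 1 ∧ U * U.conjTranspose = 1 ∧
      Q = U * !![1, 0; 0, 0] * U.conjTranspose := by
  obtain ⟨hs, hi, hr⟩ := hQ
  have hH : Q.IsHermitian := hs
  obtain ⟨U, d, h1, h2, hU⟩ : ∃ (U : Matrix (Fin 2) (Fin 2) ℂ) (d : Fin 2 → ℂ),
      U.conjTranspose * U = 1 ∧ U * U.conjTranspose = 1 ∧
      Q = U * Matrix.diagonal d * U.conjTranspose := by
    refine ⟨hH.eigenvectorUnitary, RCLike.ofReal ∘ hH.eigenvalues, Unitary.coe_star_mul_self hH.eigenvectorUnitary,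
      Unitary.coe_mul_star_self hH.eigenvectorUnitary, ?_⟩
    exact hH.spectral_theorem
  have hD : Matrix.diagonal d = U.conjTranspose * Q * U := by
    rw [hU]
    calc Matrix.diagonal d = (U.conjTranspose * U) * Matrix.diagonal d * (U.conjTranspose * U) := by
          rw [h1]; simp
      _ = _ := by simp only [Matrix.mul_assoc]
  have hDD : Matrix.diagonal d * Matrix.diagonal d = Matrix.diagonal d := by
    rw [hD]
    calc _ = U.conjTranspose * Q * (U * U.conjTranspose) * Q * U := by simp only [Matrix.mul_assoc]
      _ = U.conjTranspose * (Q * Q) * U := by rw [h2]; simp only [Matrix.mul_assoc, Matrix.one_mul]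
      _ = _ := by rw [hi]
  have hd : ∀ i, d i = 0 ∨ d i = 1 := by
    intro i
    have := congrFun (congrFun hDD i) i
    rw [Matrix.diagonal_mul_diagonal] at this
    simp only [Matrix.diagonal_apply_eq] at this
    have h : d i * (d i - 1) = 0 := by linear_combination this
    rcases mul_eq_zero.mp h with h | h
    · exact Or.inl h
    · exact Or.inr (by linear_combination h)
  rcases hd 0 with h0 | h0 <;> rcases hd 1 with h1' | h1'
  · exfalso
    have : Matrix.diagonal d = 0 := by
      ext i j; fin_cases i <;> fin_cases j <;> simp [h0, h1']
    rw [hU, this] at hr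
    simp at hr
  · have hP : Matrix.diagonal d = !![0, 1; 1, 0] * !![1, 0; 0, 0] * !![0, 1; 1, 0] := by
      ext i j; fin_cases i <;> fin_cases j <;> simp [h0, h1']
    have hPs : (!![0, 1; 1, 0] : Matrix (Fin 2) (Fin 2) ℂ).conjTranspose = !![0, 1; 1, 0] := by
      ext i j; fin_cases i <;> fin_cases j <;> simp
    have hPP : (!![0, 1; 1, 0] : Matrix (Fin 2) (Fin 2) ℂ) * !![0, 1; 1, 0] = 1 := by
      ext i j; fin_cases i <;> fin_cases j <;> simp
    refine ⟨U * !![0, 1; 1, 0], ?_, ?_, ?_⟩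
    · rw [Matrix.conjTranspose_mul, hPs, Matrix.mul_assoc, ← Matrix.mul_assoc _ U, h1,
        Matrix.one_mul, hPP]
    · rw [Matrix.conjTranspose_mul, hPs, Matrix.mul_assoc, ← Matrix.mul_assoc _ _ U.conjTranspose,
        hPP, Matrix.one_mul, h2]
    · rw [Matrix.conjTranspose_mul, hPs, hU, hP]
      simp only [Matrix.mul_assoc]
  · refine ⟨U, h1, h2, ?_⟩
    have : Matrix.diagonal d = !![1, 0; 0, 0] := by
      ext i j; fin_cases i <;> fin_cases j <;> simp [h0, h1']
    rw [hU, this]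
  · exfalso
    have : Matrix.diagonal d = 1 := by
      ext i j; fin_cases i <;> fin_cases j <;> simp [h0, h1']
    rw [hU, this, Matrix.mul_one, h2] at hr
    simp at hr



/-- A matrix function on the disc intertwines two rank-one orthogonal projections
iff it is unitarily equivalent to a diagonal matrix function. -/
theorem intertwining_projections_iff_diagonalizable
    (Θ : ℂ → Matrix (Fin 2) (Fin 2) ℂ) :
    (∃ Q₁ Q₂ : Matrix (Fin 2) (Fin 2) ℂ, IsRankOneProj Q₁ ∧ IsRankOneProj Q₂ ∧
      ∀ z ∈ ball (0 : ℂ) 1, Θ z * Q₂ = Q₁ * Θ z) ↔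
    (∃ W₁ W₂ : Matrix (Fin 2) (Fin 2) ℂ,
      W₁.conjTranspose * W₁ = 1 ∧ W₁ * W₁.conjTranspose = 1 ∧
      W₂.conjTranspose * W₂ = 1 ∧ W₂ * W₂.conjTranspose = 1 ∧
      ∃ θ₁ θ₂ : ℂ → ℂ,
        ∀ z ∈ ball (0 : ℂ) 1, W₁ * Θ z * W₂ = !![θ₁ z, 0; 0, θ₂ z]) := by


  constructor
  · rintro ⟨Q₁, Q₂, hQ₁, hQ₂, h⟩
    obtain ⟨U, u1, u2, rfl⟩ := exists_unit_conj Q₁ hQ₁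
    obtain ⟨V, v1, v2, rfl⟩ := exists_unit_conj Q₂ hQ₂
    refine ⟨U.conjTranspose, V, by simpa using u2, by simpa using u1, v1, v2,
      fun z => (U.conjTranspose * Θ z * V) 0 0, fun z => (U.conjTranspose * Θ z * V) 1 1, ?_⟩
    intro z hz
    have key : (U.conjTranspose * Θ z * V) * !![1, 0; 0, 0]
        = !![1, 0; 0, 0] * (U.conjTranspose * Θ z * V) := by
      generalize (!![1, 0; 0, 0] : Matrix (Fin 2) (Fin 2) ℂ) = E at h ⊢
      calc U.conjTranspose * Θ z * V * E
          = U.conjTranspose * Θ z * V * E * (V.conjTranspose * V) := by rw [v1, Matrix.mul_one]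
        _ = U.conjTranspose * (Θ z * (V * E * V.conjTranspose)) * V := by
            simp only [Matrix.mul_assoc]
        _ = (U.conjTranspose * U) * (E * (U.conjTranspose * Θ z * V)) := by
            rw [h z hz]; simp only [Matrix.mul_assoc]
        _ = _ := by rw [u1, Matrix.one_mul]
    beta_reduce
    generalize U.conjTranspose * Θ z * V = M at key ⊢
    have k1 := congrFun (congrFun key 0) 1
    have k2 := congrFun (congrFun key 1) 0
    simp [Matrix.mul_apply, Fin.sum_univ_two] at k1 k2
    ext i j; fin_cases i <;> fin_cases j <;> simp [k1, k2]
  · rintro ⟨U, V, u1, u2, v1, v2, a, b, h⟩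
    refine ⟨U.conjTranspose * !![1, 0; 0, 0] * U.conjTranspose.conjTranspose,
      V * !![1, 0; 0, 0] * V.conjTranspose,
      unit_conj_proj U.conjTranspose _ (by simpa using u2) (by simpa using u1) rfl,
      unit_conj_proj _ _ v1 v2 rfl, ?_⟩
    intro z hz
    have key : (U * Θ z * V) * !![1, 0; 0, 0] = !![1, 0; 0, 0] * (U * Θ z * V) := by
      rw [h z hz]; simp
    rw [Matrix.conjTranspose_conjTranspose]
    generalize (!![1, 0; 0, 0] : Matrix (Fin 2) (Fin 2) ℂ) = E at key ⊢
    calc Θ z * (V * E * V.conjTranspose)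
        = (U.conjTranspose * U) * (Θ z * (V * E * V.conjTranspose)) := by
          rw [u1, Matrix.one_mul]
      _ = U.conjTranspose * ((U * Θ z * V) * E) * V.conjTranspose := by
          simp only [Matrix.mul_assoc]
      _ = U.conjTranspose * E * U * Θ z * (V * V.conjTranspose) := by
          rw [key]; simp only [Matrix.mul_assoc]
      _ = _ := by rw [v2, Matrix.mul_one]
end

section
/- Let d be analytic on the open unit disc 𝔻 with d not identically zero, and set Θ(λ) = [[0, λ·d(λ)], [d(λ), 0]] for λ ∈ 𝔻. Then rank-one orthogonal projections Q₁, Q₂ on ℂ² satisfy Θ(λ)Q₂ = Q₁Θ(λ) for all λ ∈ 𝔻 if and only if either Q₁ = [[1,0],[0,0]] and Q₂ = [[0,0],[0,1]], or Q₁ = [[0,0],[0,1]] and Q₂ = [[1,0],[0,0]]. -/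
open Metric

theorem diag_cases (Q : Matrix (Fin 2) (Fin 2) ℂ) (hQ : IsRankOneProj Q) (h01 : Q 0 1 = 0) :
    Q = !![1, 0; 0, 0] ∨ Q = !![0, 0; 0, 1] := by
  obtain ⟨hs, hi, hr⟩ := hQ
  have h10 : Q 1 0 = 0 := by
    have := congrFun (congrFun hs 1) 0
    rw [Matrix.conjTranspose_apply, h01, star_zero] at this
    exact this.symm
  have ha := congrFun (congrFun hi 0) 0
  have hc := congrFun (congrFun hi 1) 1
  simp only [Matrix.mul_apply, Fin.sum_univ_two, h01, h10, mul_zero, add_zero, zero_add] at ha hc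
  have key : Q = !![Q 0 0, 0; 0, Q 1 1] := by
    ext i j; fin_cases i <;> fin_cases j <;> simp [h01, h10]
  have ha' : Q 0 0 = 0 ∨ Q 0 0 = 1 := by
    rcases eq_or_ne (Q 0 0) 0 with h | h
    · exact Or.inl h
    · exact Or.inr (mul_left_cancel₀ h (by rw [ha, mul_one]))
  have hc' : Q 1 1 = 0 ∨ Q 1 1 = 1 := by
    rcases eq_or_ne (Q 1 1) 0 with h | h
    · exact Or.inl h
    · exact Or.inr (mul_left_cancel₀ h (by rw [hc, mul_one]))
  rcases ha' with h | h <;> rcases hc' with h' | h' <;> rw [h, h'] at key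
  · exfalso
    have : Q = 0 := by rw [key]; ext i j; fin_cases i <;> fin_cases j <;> rfl
    rw [this, Matrix.rank_zero] at hr
    exact absurd hr (by norm_num)
  · exact Or.inr key
  · exact Or.inl key
  · exfalso
    have : Q = 1 := by rw [key, Matrix.one_fin_two]
    rw [this, Matrix.rank_one] at hr
    simp at hr

/-- Case I: for `Θ(λ) = [[0, λd(λ)], [d(λ), 0]]` with `d` analytic and not identically
zero, the intertwining rank-one projections are exactly the two standard ones. -/
theorem case_I_intertwining
    (d : ℂ → ℂ) (hd : DifferentiableOn ℂ d (ball (0 : ℂ) 1))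
    (hne : ∃ z ∈ ball (0 : ℂ) 1, d z ≠ 0)
    (Q₁ Q₂ : Matrix (Fin 2) (Fin 2) ℂ)
    (hQ₁ : IsRankOneProj Q₁) (hQ₂ : IsRankOneProj Q₂) :
    (∀ z ∈ ball (0 : ℂ) 1, !![0, z * d z; d z, 0] * Q₂ = Q₁ * !![0, z * d z; d z, 0]) ↔
      ((Q₁ = !![1, 0; 0, 0] ∧ Q₂ = !![0, 0; 0, 1]) ∨
       (Q₁ = !![0, 0; 0, 1] ∧ Q₂ = !![1, 0; 0, 0])) := by
  constructor
  · intro H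
    obtain ⟨z, hz, hdz⟩ := hne
    have h := H z hz
    have s1 : star (Q₁ 0 1) = Q₁ 1 0 := congrFun (congrFun hQ₁.1 1) 0
    have s2 : star (Q₂ 0 1) = Q₂ 1 0 := congrFun (congrFun hQ₂.1 1) 0
    have e00 := congrFun (congrFun h 0) 0
    have e10 := congrFun (congrFun h 1) 0
    have e11 := congrFun (congrFun h 1) 1
    simp only [Matrix.mul_apply, Fin.sum_univ_two, Matrix.of_apply, Matrix.cons_val_zero,
      Matrix.cons_val_one, Matrix.cons_val', Matrix.cons_val_fin_one] at e00 e10 e11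
    have e00' : z * Q₂ 1 0 = Q₁ 0 1 := mul_left_cancel₀ hdz (by linear_combination e00)
    have e10' : Q₂ 0 0 = Q₁ 1 1 := mul_left_cancel₀ hdz (by linear_combination e10)
    have e11' : Q₂ 0 1 = Q₁ 1 0 * z := mul_left_cancel₀ hdz (by linear_combination e11)
    have n1 : ‖Q₁ 1 0‖ = ‖Q₁ 0 1‖ := by rw [← s1, norm_star]
    have n2 : ‖Q₂ 1 0‖ = ‖Q₂ 0 1‖ := by rw [← s2, norm_star]
    have hz1 : ‖z‖ < 1 := by simpa using hz
    have hb : ‖z‖ * (‖Q₁ 0 1‖ * ‖z‖) = ‖Q₁ 0 1‖ := by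
      rw [← n1, ← norm_mul, ← e11', ← n2, ← norm_mul, e00', n1]
    have b0 : Q₁ 0 1 = 0 := by
      rw [← norm_eq_zero]
      have := norm_nonneg (Q₁ 0 1)
      have := norm_nonneg z
      have h2 : ‖z‖ * ‖z‖ < 1 := by nlinarith
      nlinarith
    have f0 : Q₂ 0 1 = 0 := by rw [e11', ← s1, b0]; simp
    rcases diag_cases Q₁ hQ₁ b0 with h1 | h1 <;> rcases diag_cases Q₂ hQ₂ f0 with h2 | h2
    · rw [h1, h2] at e10'; simp at e10'
    · exact Or.inl ⟨h1, h2⟩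
    · exact Or.inr ⟨h1, h2⟩
    · rw [h1, h2] at e10'; simp at e10'
  · rintro (⟨rfl, rfl⟩ | ⟨rfl, rfl⟩) z _ <;>
      · ext i j; fin_cases i <;> fin_cases j <;> simp [Matrix.mul_apply, Fin.sum_univ_two]
end

section
/- Let b and d be analytic on the open unit disc 𝔻, neither identically zero. Let q₁, q₂ ∈ [0,1], let θ₁, θ₂ ∈ ℂ with |θ₁| = |θ₂| = 1, and set rᵢ = √(qᵢ(1−qᵢ)) for i = 1, 2. Then the matrix identity [[b(λ), λ·d(λ)], [d(λ), b(λ)]]·[[q₂, r₂·conj(θ₂)], [r₂·θ₂, 1−q₂]] = [[q₁, r₁·conj(θ₁)], [r₁·θ₁, 1−q₁]]·[[b(λ), λ·d(λ)], [d(λ), b(λ)]] holds for all λ ∈ 𝔻 if and only if r₁θ₁ = r₂θ₂, q₁ + q₂ = 1, and b(λ)(1 − 2q₁) = d(λ)(conj(θ₁) − λ·θ₁)·r₁ for all λ ∈ 𝔻. -/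
open Metric

/-- Case III computation: the intertwining identity for
`Θ(λ) = [[b(λ), λd(λ)], [d(λ), b(λ)]]` and the projections parametrized by
`(qᵢ, θᵢ)` is equivalent to the stated scalar conditions. -/
theorem case_III_intertwining_equations
    (b d : ℂ → ℂ)
    (hb : DifferentiableOn ℂ b (ball (0 : ℂ) 1))
    (hd : DifferentiableOn ℂ d (ball (0 : ℂ) 1))
    (hbne : ∃ z ∈ ball (0 : ℂ) 1, b z ≠ 0)
    (hdne : ∃ z ∈ ball (0 : ℂ) 1, d z ≠ 0)
    (q₁ q₂ : ℝ) (hq₁ : 0 ≤ q₁ ∧ q₁ ≤ 1) (hq₂ : 0 ≤ q₂ ∧ q₂ ≤ 1)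
    (θ₁ θ₂ : ℂ) (hθ₁ : ‖θ₁‖ = 1) (hθ₂ : ‖θ₂‖ = 1) :
    (∀ z ∈ ball (0 : ℂ) 1,
        !![b z, z * d z; d z, b z] *
          !![(q₂ : ℂ), (Real.sqrt (q₂ * (1 - q₂)) : ℂ) * (starRingEnd ℂ) θ₂;
             (Real.sqrt (q₂ * (1 - q₂)) : ℂ) * θ₂, ((1 - q₂ : ℝ) : ℂ)] =
        !![(q₁ : ℂ), (Real.sqrt (q₁ * (1 - q₁)) : ℂ) * (starRingEnd ℂ) θ₁;
           (Real.sqrt (q₁ * (1 - q₁)) : ℂ) * θ₁, ((1 - q₁ : ℝ) : ℂ)] *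
          !![b z, z * d z; d z, b z]) ↔
      ((Real.sqrt (q₁ * (1 - q₁)) : ℂ) * θ₁ = (Real.sqrt (q₂ * (1 - q₂)) : ℂ) * θ₂ ∧
       q₁ + q₂ = 1 ∧
       ∀ z ∈ ball (0 : ℂ) 1,
         b z * (1 - 2 * (q₁ : ℂ)) =
           d z * ((starRingEnd ℂ) θ₁ - z * θ₁) * (Real.sqrt (q₁ * (1 - q₁)) : ℂ)) := by
  generalize Real.sqrt (q₁ * (1 - q₁)) = r₁
  generalize Real.sqrt (q₂ * (1 - q₂)) = r₂
  have key : ∀ z : ℂ, (!![b z, z * d z; d z, b z] *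
          !![(q₂ : ℂ), (r₂ : ℂ) * (starRingEnd ℂ) θ₂;
             (r₂ : ℂ) * θ₂, ((1 - q₂ : ℝ) : ℂ)] =
        !![(q₁ : ℂ), (r₁ : ℂ) * (starRingEnd ℂ) θ₁;
           (r₁ : ℂ) * θ₁, ((1 - q₁ : ℝ) : ℂ)] *
          !![b z, z * d z; d z, b z]) ↔
      ((b z * q₂ + z * d z * (r₂ * θ₂) = q₁ * b z + r₁ * (starRingEnd ℂ) θ₁ * d z ∧
        b z * (r₂ * (starRingEnd ℂ) θ₂) + z * d z * (1 - q₂) =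
          q₁ * (z * d z) + r₁ * (starRingEnd ℂ) θ₁ * b z) ∧
       (d z * q₂ + b z * (r₂ * θ₂) = r₁ * θ₁ * b z + (1 - q₁) * d z ∧
        d z * (r₂ * (starRingEnd ℂ) θ₂) + b z * (1 - q₂) =
          r₁ * θ₁ * (z * d z) + (1 - q₁) * b z)) := by
    intro z
    rw [← Matrix.ext_iff]
    simp only [Fin.forall_fin_two, Matrix.mul_apply, Fin.sum_univ_two, Matrix.of_apply,
      Matrix.cons_val', Matrix.cons_val_zero, Matrix.cons_val_one, Matrix.cons_val_fin_one,
      Complex.ofReal_sub, Complex.ofReal_one]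
  simp only [key]
  constructor
  · intro h
    have hu : (r₁ : ℂ) * θ₁ = r₂ * θ₂ := by
      obtain ⟨z, hz, hbz⟩ := hbne
      obtain ⟨⟨_, h2⟩, h3, _⟩ := h z hz
      have h4 : b z * ((starRingEnd ℂ) (r₁ * θ₁ - r₂ * θ₂) + z * (r₁ * θ₁ - r₂ * θ₂)) = 0 := by
        simp only [map_sub, map_mul, Complex.conj_ofReal]
        linear_combination -h2 - z * h3
      have h5 := eq_neg_of_add_eq_zero_left ((mul_eq_zero.mp h4).resolve_left hbz)
      have h6 := congrArg norm h5
      rw [norm_neg, norm_mul, RCLike.norm_conj] at h6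
      have h7 : ‖z‖ < 1 := by simpa using hz
      have h8 : ‖(r₁ : ℂ) * θ₁ - r₂ * θ₂‖ = 0 := by
        have : ‖(r₁ : ℂ) * θ₁ - r₂ * θ₂‖ * (1 - ‖z‖) = 0 := by linarith
        exact (mul_eq_zero.mp this).resolve_right (by linarith)
      exact sub_eq_zero.mp (norm_eq_zero.mp h8)
    have hc : (q₁ : ℂ) + q₂ = 1 := by
      obtain ⟨z, hz, hdz⟩ := hdne
      obtain ⟨_, h3, _⟩ := h z hz
      apply mul_left_cancel₀ hdz
      linear_combination h3 + b z * hu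
    refine ⟨hu, by exact_mod_cast hc, fun z hz => ?_⟩
    obtain ⟨⟨h1, _⟩, _⟩ := h z hz
    linear_combination h1 - b z * hc + z * d z * hu
  · rintro ⟨hu, hc', h⟩ z hz
    have hc : (q₁ : ℂ) + q₂ = 1 := by exact_mod_cast hc'
    have hv : (r₁ : ℂ) * (starRingEnd ℂ) θ₁ = r₂ * (starRingEnd ℂ) θ₂ := by
      simpa using congrArg (starRingEnd ℂ) hu
    have h0 := h z hz
    refine ⟨⟨?_, ?_⟩, ?_, ?_⟩
    · linear_combination h0 + b z * hc - z * d z * hu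
    · linear_combination -b z * hv - z * d z * hc
    · linear_combination d z * hc - b z * hu
    · linear_combination -h0 - b z * hc - d z * hv
end

section
/- Let b and d be analytic on the open unit disc 𝔻, neither identically zero, and set Θ(λ) = [[b(λ), λ·d(λ)], [d(λ), b(λ)]] for λ ∈ 𝔻. Then there exist rank-one orthogonal projections Q₁, Q₂ on ℂ² satisfying Θ(λ)Q₂ = Q₁Θ(λ) for all λ ∈ 𝔻 if and only if there exist ρ ∈ ℝ with ρ ≠ 0 and θ ∈ ℂ with |θ| = 1 such that b(λ) = ρ·(conj(θ) − λ·θ)·d(λ) for all λ ∈ 𝔻. -/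
open Metric

lemma proj_form {Q : Matrix (Fin 2) (Fin 2) ℂ} (h : IsRankOneProj Q) :
    ∃ (p : ℝ) (q : ℂ), Q = !![(p : ℂ), q; (starRingEnd ℂ) q, 1 - p] ∧
      q * (starRingEnd ℂ) q = p * (1 - p) := by
  obtain ⟨h1, h2, h3⟩ := h
  have e00 := congrFun (congrFun h1 0) 0
  have e10 := congrFun (congrFun h1 1) 0
  simp only [Matrix.conjTranspose_apply] at e00 e10
  have hdet : Q.det = 0 := by
    by_contra hne
    have := Matrix.rank_of_isUnit Q ((Matrix.isUnit_iff_isUnit_det Q).2 (isUnit_iff_ne_zero.2 hne))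
    simp [h3] at this
  rw [Matrix.det_fin_two] at hdet
  have f00 := congrFun (congrFun h2 0) 0
  have f01 := congrFun (congrFun h2 0) 1
  have f10 := congrFun (congrFun h2 1) 0
  have f11 := congrFun (congrFun h2 1) 1
  simp only [Matrix.mul_apply, Fin.sum_univ_two] at f00 f01 f10 f11
  have htr : Q 0 0 + Q 1 1 = 1 := by
    by_contra hne
    have hne' : Q 0 0 + Q 1 1 - 1 ≠ 0 := sub_ne_zero.2 hne
    have : Q = 0 := by
      ext i j
      apply mul_left_cancel₀ hne'
      fin_cases i <;> fin_cases j <;> simp [-mul_eq_zero]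
      · linear_combination f00 + hdet
      · linear_combination f01
      · linear_combination f10
      · linear_combination f11 + hdet
    simp [this] at h3
  have hre : ((Q 0 0).re : ℂ) = Q 0 0 := Complex.conj_eq_iff_re.1 e00
  refine ⟨(Q 0 0).re, Q 0 1, ?_, ?_⟩
  · rw [hre]
    ext i j
    fin_cases i <;> fin_cases j <;> simp
    · exact e10.symm
    · linear_combination htr
  · rw [hre]
    have e : (starRingEnd ℂ) (Q 0 1) = Q 1 0 := e10
    rw [e]
    linear_combination Q 0 0 * htr - hdet

lemma proj_mk (p : ℝ) (q : ℂ) (hq : q ≠ 0) (h : q * (starRingEnd ℂ) q = p * (1 - p)) :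
    IsRankOneProj !![(p : ℂ), q; (starRingEnd ℂ) q, 1 - p] := by
  refine ⟨?_, ?_, ?_⟩
  · ext i j
    fin_cases i <;> fin_cases j <;> simp
  · ext i j
    fin_cases i <;> fin_cases j <;> simp [Matrix.mul_apply, Fin.sum_univ_two]
    · linear_combination h
    · ring
    · ring
    · linear_combination h
  · have hp : (p : ℂ) ≠ 0 := by
      intro hp
      rw [hp] at h
      simp [hq] at h
    have hv : !![(p : ℂ), q; (starRingEnd ℂ) q, 1 - p]
        = Matrix.vecMulVec ![(p : ℂ), (starRingEnd ℂ) q] ![1, q / p] := by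
      ext i j
      fin_cases i <;> fin_cases j <;> simp [Matrix.vecMulVec_apply]
      · field_simp
      · field_simp
        linear_combination -h
    apply le_antisymm
    · rw [hv]; exact Matrix.rank_vecMulVec_le _ _
    · rw [Nat.one_le_iff_ne_zero]
      intro h0
      rw [Matrix.rank, Submodule.finrank_eq_zero, LinearMap.range_eq_bot] at h0
      have h1 := LinearMap.congr_fun h0 ![0, 1]
      have := congrFun h1 0
      simp [hq, Matrix.mulVec, dotProduct] at this

lemma eq_zero_of_conj {a z : ℂ} (hz : ‖z‖ < 1) (h : a = z * (starRingEnd ℂ) a) : a = 0 := by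
  by_contra ha
  have h1 := congrArg norm h
  rw [norm_mul, RCLike.norm_conj] at h1
  have := norm_pos_iff.2 ha
  nlinarith

/-- For `Θ(λ) = [[b(λ), λd(λ)], [d(λ), b(λ)]]` with `b`, `d` analytic and neither
identically zero, intertwining rank-one projections exist iff
`b(λ) ≡ ρ(conj θ − λθ)d(λ)` for some real `ρ ≠ 0` and unimodular `θ`. -/
theorem case_III_reducibility_criterion
    (b d : ℂ → ℂ)
    (hb : DifferentiableOn ℂ b (ball (0 : ℂ) 1))
    (hd : DifferentiableOn ℂ d (ball (0 : ℂ) 1))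
    (hbne : ∃ z ∈ ball (0 : ℂ) 1, b z ≠ 0)
    (hdne : ∃ z ∈ ball (0 : ℂ) 1, d z ≠ 0) :
    (∃ Q₁ Q₂ : Matrix (Fin 2) (Fin 2) ℂ, IsRankOneProj Q₁ ∧ IsRankOneProj Q₂ ∧
      ∀ z ∈ ball (0 : ℂ) 1,
        !![b z, z * d z; d z, b z] * Q₂ = Q₁ * !![b z, z * d z; d z, b z]) ↔
    (∃ ρ : ℝ, ρ ≠ 0 ∧ ∃ θ : ℂ, ‖θ‖ = 1 ∧
      ∀ z ∈ ball (0 : ℂ) 1,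
        b z = (ρ : ℂ) * ((starRingEnd ℂ) θ - z * θ) * d z) := by
  constructor
  · rintro ⟨Q₁, Q₂, h1, h2, H⟩
    obtain ⟨p₁, q₁, rfl, e1⟩ := proj_form h1
    obtain ⟨p₂, q₂, rfl, e2⟩ := proj_form h2
    have H11 : ∀ z ∈ ball (0 : ℂ) 1,
        b z * p₂ + z * d z * (starRingEnd ℂ) q₂ = p₁ * b z + q₁ * d z := by
      intro z hz
      have := congrFun (congrFun (H z hz) 0) 0
      simpa [Matrix.mul_apply, Fin.sum_univ_two] using this
    have H21 : ∀ z ∈ ball (0 : ℂ) 1,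
        d z * p₂ + b z * (starRingEnd ℂ) q₂ = (starRingEnd ℂ) q₁ * b z + (1 - p₁) * d z := by
      intro z hz
      have := congrFun (congrFun (H z hz) 1) 0
      simpa [Matrix.mul_apply, Fin.sum_univ_two] using this
    have H22 : ∀ z ∈ ball (0 : ℂ) 1,
        d z * q₂ + b z * (1 - p₂) = (starRingEnd ℂ) q₁ * (z * d z) + (1 - p₁) * b z := by
      intro z hz
      have := congrFun (congrFun (H z hz) 1) 1
      simpa [Matrix.mul_apply, Fin.sum_univ_two] using this
    obtain ⟨w, hw, hdw⟩ := hdne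
    have hw' : ‖w‖ < 1 := by simpa using hw
    have hq : q₁ - q₂ = 0 := by
      apply eq_zero_of_conj (z := -w) (by simpa using hw')
      apply mul_left_cancel₀ hdw
      rw [map_sub]
      linear_combination -(H11 w hw) - (H22 w hw)
    obtain rfl : q₁ = q₂ := sub_eq_zero.1 hq
    have hp : (p₂ : ℂ) = 1 - p₁ := by
      apply mul_left_cancel₀ hdw
      linear_combination H21 w hw
    rw [hp] at H11
    have hq0 : q₁ ≠ 0 := by
      rintro rfl
      obtain ⟨v, hv, hbv⟩ := hbne
      have h3 := H11 v hv
      simp only [map_zero, zero_mul, mul_zero, add_zero] at h3 e1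
      have h4 : (1 : ℂ) - p₁ = p₁ := by
        apply mul_left_cancel₀ hbv
        linear_combination h3
      rw [h4] at e1
      have h5 : (p₁ : ℂ) = 0 := by simpa using e1.symm
      rw [h5] at h4
      simp at h4
    have hr0 : (1 : ℝ) - 2 * p₁ ≠ 0 := by
      intro h0
      have h0' : (1 : ℂ) - 2 * p₁ = 0 := by exact_mod_cast h0
      apply hq0
      apply eq_zero_of_conj hw'
      apply mul_left_cancel₀ hdw
      linear_combination b w * h0' - H11 w hw
    have hr0' : (1 : ℂ) - 2 * p₁ ≠ 0 := by exact_mod_cast hr0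
    have hn : ‖q₁‖ ≠ 0 := norm_ne_zero_iff.2 hq0
    have hn' : (‖q₁‖ : ℂ) ≠ 0 := by exact_mod_cast hn
    refine ⟨‖q₁‖ / (1 - 2 * p₁), div_ne_zero hn hr0, (starRingEnd ℂ) q₁ / ‖q₁‖, ?_, ?_⟩
    · simp [hn]
    · intro z hz
      simp only [map_div₀, Complex.conj_conj, Complex.conj_ofReal]
      push_cast
      field_simp
      linear_combination H11 z hz
  · rintro ⟨ρ, hρ, θ, hθ, H⟩
    obtain ⟨r, hr, hr2⟩ : ∃ r : ℝ, r ≠ 0 ∧ r ^ 2 * (4 * ρ ^ 2 + 1) = ρ ^ 2 := by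
      have hpos : 0 < ρ ^ 2 / (4 * ρ ^ 2 + 1) := by positivity
      refine ⟨√(ρ ^ 2 / (4 * ρ ^ 2 + 1)), (Real.sqrt_pos.2 hpos).ne', ?_⟩
      rw [Real.sq_sqrt hpos.le]
      field_simp
    have hθ0 : θ ≠ 0 := by rintro rfl; simp at hθ
    have hθθ : θ * (starRingEnd ℂ) θ = 1 := by
      rw [Complex.mul_conj']; simp [hθ]
    have hρ' : (ρ : ℂ) ≠ 0 := by exact_mod_cast hρ
    have hr' : (r : ℂ) ≠ 0 := by exact_mod_cast hr
    have hr2' : (r : ℂ) ^ 2 * (4 * ρ ^ 2 + 1) = ρ ^ 2 := by exact_mod_cast hr2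
    have hq0 : (r : ℂ) * (starRingEnd ℂ) θ ≠ 0 := by simp [hr, hθ0]
    have key : (r : ℂ) ^ 2 = (1 - r / ρ) / 2 * ((1 + r / ρ) / 2) := by
      field_simp
      linear_combination hr2'
    refine ⟨_, _, proj_mk ((1 - r / ρ) / 2) (r * (starRingEnd ℂ) θ) hq0 ?_,
      proj_mk ((1 + r / ρ) / 2) (r * (starRingEnd ℂ) θ) hq0 ?_, ?_⟩
    · simp only [map_mul, Complex.conj_conj, Complex.conj_ofReal]
      push_cast
      linear_combination (r : ℂ) ^ 2 * hθθ + key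
    · simp only [map_mul, Complex.conj_conj, Complex.conj_ofReal]
      push_cast
      linear_combination (r : ℂ) ^ 2 * hθθ + key
    · intro z hz
      rw [H z hz]
      ext i j
      fin_cases i <;> fin_cases j <;>
        simp [Matrix.mul_apply, Fin.sum_univ_two] <;> field_simp <;> ring
end

section
/- Let m be analytic on the open unit disc 𝔻 and not identically zero, let b and d be the analytic functions on 𝔻 determined by b(λ²) = m(λ) + m(−λ) and λ·d(λ²) = m(λ) − m(−λ) for all λ ∈ 𝔻, and set Θ(λ) = (1/2)·[[b(λ), λ·d(λ)], [d(λ), b(λ)]]. Then there exist rank-one orthogonal projections Q₁, Q₂ on ℂ² satisfying Θ(λ)Q₂ = Q₁Θ(λ) for all λ ∈ 𝔻 if and only if one of the following holds: (i) m(−λ) = −m(λ) for all λ ∈ 𝔻; (ii) m(−λ) = m(λ) for all λ ∈ 𝔻; (iii) there exist ρ ∈ ℝ with ρ ≠ 0 and θ ∈ ℂ with |θ| = 1 such that the function n(λ) = m(λ)·(ρθλ² + λ − ρ·conj(θ)) satisfies n(λ) = n(−λ) for all λ ∈ 𝔻. -/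
open Metric

lemma aux_rank_pos (Q : Matrix (Fin 2) (Fin 2) ℂ) (h : Q ≠ 0) : 1 ≤ Q.rank := by
  by_contra hc
  have h0 : Q.rank = 0 := by omega
  apply h
  unfold Matrix.rank at h0
  rw [Submodule.finrank_eq_zero, LinearMap.range_eq_bot] at h0
  ext i j
  have := congrFun (LinearMap.congr_fun h0 (Pi.single j 1)) i
  simpa using this

lemma aux_mk (p : ℝ) (q : ℂ) (h : (p : ℂ) * (1 - p) = q * (starRingEnd ℂ) q) :
    IsRankOneProj !![(p : ℂ), q; (starRingEnd ℂ) q, 1 - p] := by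
  have hQQ : !![(p : ℂ), q; (starRingEnd ℂ) q, 1 - p] * !![(p : ℂ), q; (starRingEnd ℂ) q, 1 - p]
      = !![(p : ℂ), q; (starRingEnd ℂ) q, 1 - p] := by
    ext i j
    fin_cases i <;> fin_cases j <;> simp [Matrix.mul_apply, Fin.sum_univ_two]
    · linear_combination -h
    · ring
    · ring
    · linear_combination -h
  refine ⟨?_, hQQ, ?_⟩
  · ext i j
    fin_cases i <;> fin_cases j <;> simp [Matrix.conjTranspose_apply]
  · set Q := !![(p : ℂ), q; (starRingEnd ℂ) q, 1 - p] with hQ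
    have h1 : 1 ≤ Q.rank := by
      apply aux_rank_pos
      intro h0
      have h00 := congrFun (congrFun h0 0) 0
      have h11 := congrFun (congrFun h0 1) 1
      simp [hQ] at h00 h11
      simp [h00] at h11
    have h2 : 1 ≤ (1 - Q).rank := by
      apply aux_rank_pos
      intro h0
      have h00 := congrFun (congrFun h0 0) 0
      have h11 := congrFun (congrFun h0 1) 1
      simp [hQ] at h00 h11
      simp [h11] at h00
    have h3 : Q.rank + (1 - Q).rank ≤ Fintype.card (Fin 2) := by
      apply Matrix.rank_add_rank_le_card_of_mul_eq_zero
      rw [mul_sub, hQQ, mul_one, sub_self]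
    simp at h3
    omega

lemma aux_elim (Q : Matrix (Fin 2) (Fin 2) ℂ) (h : IsRankOneProj Q) :
    ∃ (p : ℝ) (q : ℂ), (p : ℂ) * (1 - p) = q * (starRingEnd ℂ) q ∧
      Q = !![(p : ℂ), q; (starRingEnd ℂ) q, 1 - p] := by
  obtain ⟨hs, hq, hr⟩ := h
  have hdet : Q.det = 0 := by
    by_contra hd
    have := Matrix.rank_of_det_ne_zero hd
    simp [hr] at this
  rw [Matrix.det_fin_two] at hdet
  have e (i j) : Q i 0 * Q 0 j + Q i 1 * Q 1 j = Q i j := by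
    have := congrFun (congrFun hq i) j
    simpa [Matrix.mul_apply, Fin.sum_univ_two] using this
  have htr : Q 0 0 + Q 1 1 = 1 := by
    by_contra ht
    have ht' : Q 0 0 + Q 1 1 - 1 ≠ 0 := sub_ne_zero.mpr ht
    have hz : Q = 0 := by
      ext i j
      apply (mul_eq_zero.mp (?_ : (Q 0 0 + Q 1 1 - 1) * Q i j = 0)).resolve_left ht'
      have := e i j
      fin_cases i <;> fin_cases j <;> simp [-mul_eq_zero] at this ⊢
      · linear_combination this + hdet
      · linear_combination this
      · linear_combination this
      · linear_combination this + hdet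
    rw [hz] at hr
    simp at hr
  have c00 : (starRingEnd ℂ) (Q 0 0) = Q 0 0 := congrFun (congrFun hs 0) 0
  have c10 : (starRingEnd ℂ) (Q 0 1) = Q 1 0 := congrFun (congrFun hs 1) 0
  obtain ⟨p, hp⟩ := Complex.conj_eq_iff_real.mp c00
  refine ⟨p, Q 0 1, ?_, ?_⟩
  · rw [c10, ← hp]
    linear_combination hdet - Q 0 0 * htr
  · rw [c10, ← hp]
    ext i j
    fin_cases i <;> fin_cases j <;> simp
    linear_combination htr

lemma aux_ne (q z : ℂ) (hz : z ∈ ball (0 : ℂ) 1) (h : q - z * (starRingEnd ℂ) q = 0) : q = 0 := by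
  have hz' : ‖z‖ < 1 := by simpa using hz
  have h1 : ‖q‖ = ‖z‖ * ‖q‖ := by
    conv_lhs => rw [sub_eq_zero.mp h]
    simp
  have : ‖q‖ = 0 := by
    by_contra hne
    have : 0 < ‖q‖ := lt_of_le_of_ne (norm_nonneg _) (Ne.symm hne)
    nlinarith
  simpa using this

lemma aux_sq (w : ℂ) (hw : w ∈ ball (0 : ℂ) 1) : ∃ z ∈ ball (0 : ℂ) 1, z ^ 2 = w := by
  obtain ⟨z, hz⟩ := (⟨_, (Complex.cpow_nat_inv_pow w two_ne_zero).symm⟩ : ∃ z : ℂ, w = z ^ 2)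
  refine ⟨z, ?_, hz.symm⟩
  simp only [mem_ball_zero_iff] at hw ⊢
  rw [hz, norm_pow] at hw
  nlinarith [norm_nonneg z]

lemma aux_cont (f : ℂ → ℂ) (hf : ContinuousOn f (ball (0 : ℂ) 1))
    (h : ∀ z ∈ ball (0 : ℂ) 1, z * f (z ^ 2) = 0) : ∀ z ∈ ball (0 : ℂ) 1, f z = 0 := by
  have h1 : ∀ z ∈ ball (0 : ℂ) 1, z ≠ 0 → f z = 0 := by
    intro w hw hne
    obtain ⟨z, hz, rfl⟩ := aux_sq w hw
    have hz0 : z ≠ 0 := by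
      rintro rfl
      simp at hne
    exact (mul_eq_zero.mp (h z hz)).resolve_left hz0
  intro z hz
  by_cases hz0 : z = 0
  · subst hz0
    have hc : ContinuousAt f 0 := hf.continuousAt (isOpen_ball.mem_nhds hz)
    have ht : Filter.Tendsto f (nhdsWithin 0 {0}ᶜ) (nhds (f 0)) := hc.mono_left nhdsWithin_le_nhds
    have ht2 : Filter.Tendsto f (nhdsWithin 0 {0}ᶜ) (nhds 0) := by
      refine tendsto_const_nhds.congr' ?_
      filter_upwards [self_mem_nhdsWithin, mem_nhdsWithin_of_mem_nhds (isOpen_ball.mem_nhds hz)]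
        with x hx hx2
      exact (h1 x hx2 hx).symm
    exact tendsto_nhds_unique ht ht2
  · exact h1 z hz hz0

lemma aux_mat (b d z p q r s : ℂ) (q' s' : ℂ) :
    (((1 / 2 : ℂ) • !![b, z * d; d, b]) * !![p, q; q', 1 - p] =
      !![r, s; s', 1 - r] * ((1 / 2 : ℂ) • !![b, z * d; d, b])) ↔
    (b * (p - r) = d * (s - z * q') ∧ b * (q - s) = z * (d * (r + p - 1)) ∧
      b * (q' - s') = d * (1 - r - p) ∧ b * (r - p) = d * (s' * z - q)) := by
  constructor
  · intro h
    have e (i j) := congrFun (congrFun h i) j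
    have e00 := e 0 0
    have e01 := e 0 1
    have e10 := e 1 0
    have e11 := e 1 1
    simp [Matrix.mul_apply, Fin.sum_univ_two] at e00 e01 e10 e11
    refine ⟨?_, ?_, ?_, ?_⟩
    · linear_combination 2 * e00
    · linear_combination 2 * e01
    · linear_combination 2 * e10
    · linear_combination 2 * e11
  · rintro ⟨h1, h2, h3, h4⟩
    ext i j
    fin_cases i <;> fin_cases j <;> simp [Matrix.mul_apply, Fin.sum_univ_two]
    · linear_combination h1 / 2
    · linear_combination h2 / 2
    · linear_combination h3 / 2
    · linear_combination h4 / 2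

/-- Lemma 3: the characteristic function `Θ` of `T²` admits intertwining rank-one
projections iff `m` is odd, `m` is even, or `n(λ) = m(λ)(ρθλ² + λ − ρ·conj θ)` is even
for some real `ρ ≠ 0` and unimodular `θ`. -/
theorem lemma3_reducibility
    (m b d : ℂ → ℂ)
    (hm : DifferentiableOn ℂ m (ball (0 : ℂ) 1))
    (hmne : ∃ z ∈ ball (0 : ℂ) 1, m z ≠ 0)
    (hb : DifferentiableOn ℂ b (ball (0 : ℂ) 1))
    (hd : DifferentiableOn ℂ d (ball (0 : ℂ) 1))
    (hbm : ∀ z ∈ ball (0 : ℂ) 1, b (z ^ 2) = m z + m (-z))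
    (hdm : ∀ z ∈ ball (0 : ℂ) 1, z * d (z ^ 2) = m z - m (-z)) :
    (∃ Q₁ Q₂ : Matrix (Fin 2) (Fin 2) ℂ, IsRankOneProj Q₁ ∧ IsRankOneProj Q₂ ∧
      ∀ z ∈ ball (0 : ℂ) 1,
        ((1 / 2 : ℂ) • !![b z, z * d z; d z, b z]) * Q₂ =
          Q₁ * ((1 / 2 : ℂ) • !![b z, z * d z; d z, b z])) ↔
    ((∀ z ∈ ball (0 : ℂ) 1, m (-z) = -m z) ∨
     (∀ z ∈ ball (0 : ℂ) 1, m (-z) = m z) ∨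
     (∃ ρ : ℝ, ρ ≠ 0 ∧ ∃ θ : ℂ, ‖θ‖ = 1 ∧
       ∀ z ∈ ball (0 : ℂ) 1,
         m z * ((ρ : ℂ) * θ * z ^ 2 + z - (ρ : ℂ) * (starRingEnd ℂ) θ) =
           m (-z) * ((ρ : ℂ) * θ * (-z) ^ 2 + (-z) - (ρ : ℂ) * (starRingEnd ℂ) θ))) := by
  constructor
  · rintro ⟨Q₁, Q₂, h1, h2, h⟩
    obtain ⟨r, s, hrs, rfl⟩ := aux_elim Q₁ h1
    obtain ⟨p, q, hpq, rfl⟩ := aux_elim Q₂ h2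
    simp only [aux_mat] at h
    by_cases hb0 : ∀ z ∈ ball (0 : ℂ) 1, b z = 0
    · left
      intro z hz
      have hz2 : z ^ 2 ∈ ball (0 : ℂ) 1 := by
        simp only [mem_ball_zero_iff] at hz ⊢
        rw [norm_pow]
        nlinarith [norm_nonneg z]
      linear_combination hb0 _ hz2 - hbm z hz
    by_cases hd0 : ∀ z ∈ ball (0 : ℂ) 1, d z = 0
    · right; left
      intro z hz
      have hz2 : z ^ 2 ∈ ball (0 : ℂ) 1 := by
        simp only [mem_ball_zero_iff] at hz ⊢
        rw [norm_pow]
        nlinarith [norm_nonneg z]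
      linear_combination hdm z hz - z * hd0 _ hz2
    right; right
    push Not at hb0 hd0
    obtain ⟨x, hx, hbx⟩ := hb0
    obtain ⟨y, hy, hdy⟩ := hd0
    have hqs : q = s := by
      obtain ⟨-, k2, k3, -⟩ := h x hx
      have hx' : -x ∈ ball (0 : ℂ) 1 := by simpa using hx
      apply sub_eq_zero.mp
      apply aux_ne _ _ hx'
      rw [map_sub]
      apply (mul_eq_zero.mp (?_ : b x * _ = 0)).resolve_left hbx
      linear_combination k2 + x * k3
    subst hqs
    have hr : (r : ℂ) = 1 - p := by
      obtain ⟨-, -, k3, -⟩ := h y hy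
      have := (mul_eq_zero.mp (by linear_combination -k3 : d y * (1 - r - p : ℂ) = 0)).resolve_left hdy
      linear_combination -this
    have key : ∀ z ∈ ball (0 : ℂ) 1, b z * (2 * p - 1) = d z * (q - z * (starRingEnd ℂ) q) := by
      intro z hz
      have := (h z hz).1
      rw [hr] at this
      linear_combination this
    have hc : (2 * p - 1 : ℂ) ≠ 0 := by
      intro hc
      have k := key y hy
      rw [hc, mul_zero] at k
      have hq := aux_ne q y hy ((mul_eq_zero.mp k.symm).resolve_left hdy)
      rw [hq] at hpq
      simp at hpq
      rcases hpq with h0 | h0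
      · simp [h0] at hc
      · have : (1 : ℂ) = 0 := by linear_combination hc + 2 * h0
        exact one_ne_zero this
    have hq : q ≠ 0 := by
      rintro rfl
      have k := key x hx
      simp at k
      exact k.elim hbx hc
    have hcr : (2 * p - 1 : ℝ) ≠ 0 := by
      intro h0
      apply hc
      exact_mod_cast h0
    have hqn : ‖q‖ ≠ 0 := by simpa using hq
    have hqn' : (‖q‖ : ℂ) ≠ 0 := by exact_mod_cast hqn
    refine ⟨‖q‖ / (2 * p - 1), div_ne_zero hqn hcr, (starRingEnd ℂ) q / ‖q‖, ?_, ?_⟩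
    · simp [hqn]
    · intro z hz
      have hz2 : z ^ 2 ∈ ball (0 : ℂ) 1 := by
        simp only [mem_ball_zero_iff] at hz ⊢
        rw [norm_pow]
        nlinarith [norm_nonneg z]
      have k := key _ hz2
      rw [hbm z hz] at k
      have k2 := hdm z hz
      have e1 : ((‖q‖ / (2 * p - 1) : ℝ) : ℂ) * ((starRingEnd ℂ) q / ‖q‖)
          = (starRingEnd ℂ) q / (2 * p - 1) := by
        push_cast
        field_simp
      have e2 : ((‖q‖ / (2 * p - 1) : ℝ) : ℂ) * (starRingEnd ℂ) ((starRingEnd ℂ) q / ‖q‖)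
          = q / (2 * p - 1) := by
        rw [map_div₀, Complex.conj_conj, Complex.conj_ofReal]
        push_cast
        field_simp
      rw [e1, e2]
      have k3 : m z * ((2 * p - 1) * z - q + z ^ 2 * (starRingEnd ℂ) q)
          = m (-z) * (-(2 * p - 1) * z - q + z ^ 2 * (starRingEnd ℂ) q) := by
        linear_combination z * k + (q - z ^ 2 * (starRingEnd ℂ) q) * k2
      apply mul_left_cancel₀ hc
      have f1 : (2 * p - 1 : ℂ) * ((starRingEnd ℂ) q / (2 * p - 1)) = (starRingEnd ℂ) q :=
        mul_div_cancel₀ _ hc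
      have f2 : (2 * p - 1 : ℂ) * (q / (2 * p - 1)) = q :=
        mul_div_cancel₀ _ hc
      linear_combination k3 + (m z - m (-z)) * (z ^ 2 * f1 - f2)
  · have hbc := hb.continuousOn
    have hdc := hd.continuousOn
    rintro (h | h | ⟨ρ, hρ, θ, hθ, h⟩)
    · have hb0 : ∀ z ∈ ball (0 : ℂ) 1, b z = 0 := by
        apply aux_cont b hbc
        intro z hz
        rw [hbm z hz, h z hz]
        ring
      refine ⟨_, _, aux_mk 0 0 (by simp), aux_mk 1 0 (by simp), ?_⟩
      intro z hz
      rw [aux_mat]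
      simp [hb0 z hz]
    · have hd0 : ∀ z ∈ ball (0 : ℂ) 1, d z = 0 := by
        apply aux_cont d hdc
        intro z hz
        rw [hdm z hz, h z hz]
        ring
      refine ⟨_, _, aux_mk 1 0 (by simp), aux_mk 1 0 (by simp), ?_⟩
      intro z hz
      rw [aux_mat]
      simp [hd0 z hz]
    · obtain ⟨c, hc⟩ : ∃ c : ℝ, c ^ 2 * (1 + 4 * ρ ^ 2) = 1 := by
        refine ⟨(Real.sqrt (1 + 4 * ρ ^ 2))⁻¹, ?_⟩
        have : 0 < 1 + 4 * ρ ^ 2 := by positivity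
        rw [inv_pow, Real.sq_sqrt this.le]
        field_simp
      have hcC : (c : ℂ) ^ 2 * (1 + 4 * (ρ : ℂ) ^ 2) = 1 := by exact_mod_cast hc
      have hθ2 : θ * (starRingEnd ℂ) θ = 1 := by
        rw [Complex.mul_conj, Complex.normSq_eq_norm_sq, hθ]
        simp
      have key : ∀ z ∈ ball (0 : ℂ) 1, b z * c
          - d z * (c * ρ * (starRingEnd ℂ) θ - z * (c * ρ * θ)) = 0 := by
        apply aux_cont (fun z => b z * c
          - d z * (c * ρ * (starRingEnd ℂ) θ - z * (c * ρ * θ)))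
        · fun_prop
        · intro z hz
          rw [hbm z hz]
          linear_combination c * h z hz
            - (c * ρ * (starRingEnd ℂ) θ - z ^ 2 * (c * ρ * θ)) * hdm z hz
      refine ⟨_, _, aux_mk ((1 - c) / 2) (c * ρ * (starRingEnd ℂ) θ) ?_,
        aux_mk ((1 + c) / 2) (c * ρ * (starRingEnd ℂ) θ) ?_, ?_⟩
      · simp only [map_mul, Complex.conj_conj, Complex.conj_ofReal]
        push_cast
        linear_combination -hcC / 4 - c ^ 2 * ρ ^ 2 * hθ2
      · simp only [map_mul, Complex.conj_conj, Complex.conj_ofReal]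
        push_cast
        linear_combination -hcC / 4 - c ^ 2 * ρ ^ 2 * hθ2
      · intro z hz
        have k := key z hz
        rw [aux_mat]
        simp only [map_mul, Complex.conj_conj, Complex.conj_ofReal]
        push_cast
        refine ⟨?_, ?_, ?_, ?_⟩
        · linear_combination k
        · ring
        · ring
        · linear_combination -k
end

section
/- Let m be analytic on the open unit disc 𝔻 and let μ ∈ 𝔻. Then m(λ)·(λ − μ)/(1 − conj(μ)·λ) = m(−λ)·((−λ) − μ)/(1 + conj(μ)·λ) holds for all λ ∈ 𝔻 if and only if there exists a function p analytic on 𝔻 with p(λ) = p(−λ) for all λ ∈ 𝔻 such that m(λ) = p(λ)·(λ + μ)/(1 + conj(μ)·λ) for all λ ∈ 𝔻. -/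
open Metric

lemma aux_ne_s11 (a z0 : ℂ) : ∀ᶠ z in nhdsWithin z0 {z0}ᶜ, z ≠ a := by
  by_cases h : z0 = a
  · subst h; exact self_mem_nhdsWithin
  · exact (eventually_ne_nhds h).filter_mono nhdsWithin_le_nhds

lemma aux_zero (f : ℂ → ℂ) (hf : ContinuousOn f (ball (0 : ℂ) 1)) (a b : ℂ)
    (h : ∀ z ∈ ball (0 : ℂ) 1, f z * ((z - a) * (z - b)) = 0) :
    ∀ z ∈ ball (0 : ℂ) 1, f z = 0 := by
  intro z0 hz0
  have hn : ball (0 : ℂ) 1 ∈ nhds z0 := isOpen_ball.mem_nhds hz0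
  have hc : Filter.Tendsto f (nhdsWithin z0 {z0}ᶜ) (nhds (f z0)) :=
    (hf.continuousAt hn).tendsto.mono_left nhdsWithin_le_nhds
  have he : ∀ᶠ z in nhdsWithin z0 {z0}ᶜ, f z = 0 := by
    filter_upwards [aux_ne_s11 a z0, aux_ne_s11 b z0, mem_nhdsWithin_of_mem_nhds hn] with z h1 h2 h3
    have := h z h3
    simpa [sub_eq_zero, h1, h2] using this
  have hc' : Filter.Tendsto f (nhdsWithin z0 {z0}ᶜ) (nhds 0) :=
    tendsto_const_nhds.congr' (he.mono fun z hz => hz.symm)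
  exact tendsto_nhds_unique hc hc'

lemma aux_den (μ z : ℂ) (hμ : μ ∈ ball (0 : ℂ) 1) (hz : z ∈ ball (0 : ℂ) 1) :
    1 + (starRingEnd ℂ) μ * z ≠ 0 := by
  intro h
  rw [mem_ball_zero_iff] at hμ hz
  have h1 : (starRingEnd ℂ) μ * z = -1 := by linear_combination h
  have h2 : ‖μ‖ * ‖z‖ = 1 := by
    have := congrArg norm h1
    simpa using this
  nlinarith [norm_nonneg μ, norm_nonneg z]

/-- The functional equation `m(λ)·(λ−μ)/(1−conj(μ)λ) = m(−λ)·(−λ−μ)/(1+conj(μ)λ)` on the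
disc holds iff `m(λ) = p(λ)·(λ+μ)/(1+conj(μ)λ)` for some even analytic function `p`. -/
theorem functional_equation_iff_even_factor
    (m : ℂ → ℂ) (hm : DifferentiableOn ℂ m (ball (0 : ℂ) 1))
    (μ : ℂ) (hμ : μ ∈ ball (0 : ℂ) 1) :
    (∀ z ∈ ball (0 : ℂ) 1,
        m z * (z - μ) / (1 - (starRingEnd ℂ) μ * z) =
          m (-z) * (-z - μ) / (1 + (starRingEnd ℂ) μ * z)) ↔
    (∃ p : ℂ → ℂ, DifferentiableOn ℂ p (ball (0 : ℂ) 1) ∧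
      (∀ z ∈ ball (0 : ℂ) 1, p z = p (-z)) ∧
      ∀ z ∈ ball (0 : ℂ) 1,
        m z = p z * (z + μ) / (1 + (starRingEnd ℂ) μ * z)) := by
  have hneg : ∀ z ∈ ball (0 : ℂ) 1, -z ∈ ball (0 : ℂ) 1 := by
    intro z hz; simpa using hz
  have hd1 : ∀ z ∈ ball (0 : ℂ) 1, 1 + (starRingEnd ℂ) μ * z ≠ 0 :=
    fun z hz => aux_den μ z hμ hz
  have hd2 : ∀ z ∈ ball (0 : ℂ) 1, 1 - (starRingEnd ℂ) μ * z ≠ 0 := by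
    intro z hz
    have := hd1 (-z) (hneg z hz)
    rwa [mul_neg, ← sub_eq_add_neg] at this
  have hcneg : ∀ f : ℂ → ℂ, ContinuousOn f (ball (0 : ℂ) 1) →
      ContinuousOn (fun z => f (-z)) (ball (0 : ℂ) 1) :=
    fun f hf => hf.comp continuous_neg.continuousOn hneg
  constructor
  · intro h
    have h' : ∀ z ∈ ball (0 : ℂ) 1, m z * (z - μ) * (1 + (starRingEnd ℂ) μ * z) =
        m (-z) * (-z - μ) * (1 - (starRingEnd ℂ) μ * z) := fun z hz =>
      (div_eq_div_iff (hd2 z hz) (hd1 z hz)).1 (h z hz)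
    have hm0 : m (-μ) = 0 := by
      by_cases h0 : μ = 0
      · have := aux_zero (fun z => m z + m (-z)) (hm.continuousOn.add (hcneg m hm.continuousOn))
          0 0 (by
            intro z hz
            have := h' z hz
            simp only [h0, map_zero] at this
            linear_combination z * this) 0 (by simp)
        simp only [neg_zero] at this
        rw [h0, neg_zero]
        linear_combination this / 2
      · have := h' (-μ) (hneg μ hμ)
        have h2 : m (-μ) * (μ * (1 + (starRingEnd ℂ) μ * (-μ))) = 0 := by
          simp only [neg_neg] at this
          linear_combination (-1 / 2) * this
        have h3 := hd1 (-μ) (hneg μ hμ)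
        exact (mul_eq_zero.1 h2).resolve_right (mul_ne_zero h0 h3)
    have hs : ∀ z, (z + μ) * dslope m (-μ) z = m z := by
      intro z
      have := sub_smul_dslope m (-μ) z
      rw [hm0, smul_eq_mul] at this
      linear_combination this
    have hdp : DifferentiableOn ℂ (fun z => dslope m (-μ) z * (1 + (starRingEnd ℂ) μ * z))
        (ball (0 : ℂ) 1) := by
      refine DifferentiableOn.mul ?_ (by fun_prop)
      exact (Complex.differentiableOn_dslope (isOpen_ball.mem_nhds (hneg μ hμ))).2 hm
    refine ⟨fun z => dslope m (-μ) z * (1 + (starRingEnd ℂ) μ * z), hdp, ?_, ?_⟩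
    · intro z hz
      refine sub_eq_zero.1 (aux_zero _ (hdp.continuousOn.sub (hcneg _ hdp.continuousOn)) μ (-μ)
        ?_ z hz)
      intro z hz
      have e := h' z hz
      have e1 := hs z
      have e2 := hs (-z)
      rw [← e1, ← e2] at e
      simp only [Pi.sub_apply]
      linear_combination e
    · intro z hz
      rw [eq_div_iff (hd1 z hz), ← hs z]
      ring
  · rintro ⟨p, -, hev, hp⟩ z hz
    have e1 := hp z hz
    have e2 := hp (-z) (hneg z hz)
    rw [← hev z hz, mul_neg, ← sub_eq_add_neg] at e2
    rw [e1, e2]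
    have := hd1 z hz
    have := hd2 z hz
    field_simp
    ring
end

section
/- Let m be analytic on the open unit disc 𝔻 and let b and d be the analytic functions on 𝔻 determined by b(λ²) = m(λ) + m(−λ) and λ·d(λ²) = m(λ) − m(−λ) for all λ ∈ 𝔻. For any function q analytic on 𝔻, the following are equivalent: (i) there exist functions r, s analytic on 𝔻 with b(λ) = q(λ)·r(λ) and d(λ) = q(λ)·s(λ) for all λ ∈ 𝔻; (ii) there exists a function k analytic on 𝔻 with m(λ) = q(λ²)·k(λ) for all λ ∈ 𝔻. -/
open Metric

lemma even_descends (e : ℂ → ℂ) (he : DifferentiableOn ℂ e (ball (0 : ℂ) 1))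
    (hev : ∀ z ∈ ball (0 : ℂ) 1, e (-z) = e z) :
    ∃ r : ℂ → ℂ, DifferentiableOn ℂ r (ball (0 : ℂ) 1) ∧
      ∀ z ∈ ball (0 : ℂ) 1, r (z ^ 2) = e z := by
  have hsq : ∀ w : ℂ, (w ^ ((2 : ℕ) : ℂ)⁻¹) ^ 2 = w := fun w =>
    Complex.cpow_nat_inv_pow w two_ne_zero
  have hball : ∀ z : ℂ, z ^ 2 ∈ ball (0 : ℂ) 1 → z ∈ ball (0 : ℂ) 1 := by
    intro z hz
    rw [mem_ball_zero_iff] at hz ⊢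
    rw [norm_pow] at hz
    nlinarith [norm_nonneg z]
  have huniq : ∀ x y : ℂ, y ∈ ball (0 : ℂ) 1 → x ^ 2 = y ^ 2 → e x = e y := by
    intro x y hy h
    rcases sq_eq_sq_iff_eq_or_eq_neg.1 h with h | h
    · rw [h]
    · rw [h, hev y hy]
  set r : ℂ → ℂ := fun w => e (w ^ ((2 : ℕ) : ℂ)⁻¹) with hr
  have hrz : ∀ z ∈ ball (0 : ℂ) 1, r (z ^ 2) = e z := fun z hz =>
    huniq _ _ hz (hsq _)
  refine ⟨r, ?_, hrz⟩
  have hnhds : ball (0 : ℂ) 1 ∈ nhds (0 : ℂ) := ball_mem_nhds _ one_pos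
  refine (Complex.differentiableOn_compl_singleton_and_continuousAt_iff hnhds).1 ⟨?_, ?_⟩
  · rintro w ⟨hw, hw0⟩
    have hw0 : w ≠ 0 := hw0
    apply DifferentiableAt.differentiableWithinAt
    set c : ℂ := w ^ ((2 : ℕ) : ℂ)⁻¹ with hc
    have hcw : c ^ 2 = w := hsq w
    have hcb : c ∈ ball (0 : ℂ) 1 := hball c (by rwa [hcw])
    have key : DifferentiableAt ℂ (fun x => e (c * (x / w) ^ ((2 : ℕ) : ℂ)⁻¹)) w := by
      have h1 : DifferentiableAt ℂ (fun x : ℂ => c * (x / w) ^ ((2 : ℕ) : ℂ)⁻¹) w := by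
        refine DifferentiableAt.const_mul ?_ _
        refine DifferentiableAt.cpow_const (by fun_prop) ?_
        rw [div_self hw0]
        exact Complex.one_mem_slitPlane
      have h2 : DifferentiableAt ℂ e (c * (w / w) ^ ((2 : ℕ) : ℂ)⁻¹) := by
        rw [div_self hw0, Complex.one_cpow, mul_one]
        exact he.differentiableAt (isOpen_ball.mem_nhds hcb)
      exact DifferentiableAt.comp w h2 h1
    refine key.congr_of_eventuallyEq ?_
    filter_upwards [isOpen_ball.mem_nhds hw] with x hx
    have hx2 : (c * (x / w) ^ ((2 : ℕ) : ℂ)⁻¹) ^ 2 = x := by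
      rw [mul_pow, hcw, hsq (x / w)]; field_simp
    exact huniq _ _ (hball _ (by rwa [hx2])) ((hsq x).trans hx2.symm)
  · have h1 : ContinuousAt (fun w : ℂ => w ^ ((2 : ℕ) : ℂ)⁻¹) 0 :=
      Complex.continuousAt_cpow_const_of_re_pos (Or.inl le_rfl) (by norm_num)
    have h2 : ContinuousAt e ((0 : ℂ) ^ ((2 : ℕ) : ℂ)⁻¹) := by
      rw [Complex.zero_cpow (by norm_num)]
      exact (he.differentiableAt hnhds).continuousAt
    exact ContinuousAt.comp (f := fun w : ℂ => w ^ ((2 : ℕ) : ℂ)⁻¹) h2 h1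

/-- A common analytic divisor `q` of `b` and `d` corresponds exactly to the divisor
`q(λ²)` of `m`. -/
theorem common_divisor_iff_even_divisor
    (m b d : ℂ → ℂ)
    (hm : DifferentiableOn ℂ m (ball (0 : ℂ) 1))
    (hb : DifferentiableOn ℂ b (ball (0 : ℂ) 1))
    (hd : DifferentiableOn ℂ d (ball (0 : ℂ) 1))
    (hbm : ∀ z ∈ ball (0 : ℂ) 1, b (z ^ 2) = m z + m (-z))
    (hdm : ∀ z ∈ ball (0 : ℂ) 1, z * d (z ^ 2) = m z - m (-z))
    (q : ℂ → ℂ) (hq : DifferentiableOn ℂ q (ball (0 : ℂ) 1)) :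
    (∃ r s : ℂ → ℂ, DifferentiableOn ℂ r (ball (0 : ℂ) 1) ∧
      DifferentiableOn ℂ s (ball (0 : ℂ) 1) ∧
      ∀ z ∈ ball (0 : ℂ) 1, b z = q z * r z ∧ d z = q z * s z) ↔
    (∃ k : ℂ → ℂ, DifferentiableOn ℂ k (ball (0 : ℂ) 1) ∧
      ∀ z ∈ ball (0 : ℂ) 1, m z = q (z ^ 2) * k z) := by
  have hnhds : ball (0 : ℂ) 1 ∈ nhds (0 : ℂ) := ball_mem_nhds _ one_pos
  have hmaps : Set.MapsTo (fun z : ℂ => z ^ 2) (ball (0 : ℂ) 1) (ball (0 : ℂ) 1) := by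
    intro z hz
    rw [mem_ball_zero_iff] at hz ⊢
    rw [norm_pow]
    nlinarith [norm_nonneg z]
  have hneg : Set.MapsTo (fun z : ℂ => -z) (ball (0 : ℂ) 1) (ball (0 : ℂ) 1) := by
    intro z hz
    rw [mem_ball_zero_iff] at hz ⊢
    rwa [norm_neg]
  have hsqd : DifferentiableOn ℂ (fun z : ℂ => z ^ 2) (ball (0 : ℂ) 1) := by fun_prop
  have hnegd : DifferentiableOn ℂ (fun z : ℂ => -z) (ball (0 : ℂ) 1) := by fun_prop
  constructor
  · rintro ⟨r, s, hr, hs, h⟩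
    refine ⟨fun z => (r (z ^ 2) + z * s (z ^ 2)) / 2, ?_, ?_⟩
    · exact ((hr.comp hsqd hmaps).add (differentiableOn_id.mul (hs.comp hsqd hmaps))).div_const 2
    · intro z hz
      obtain ⟨h1, h2⟩ := h _ (hmaps hz)
      have h3 := hbm z hz
      have h4 := hdm z hz
      simp only at h1 h2
      rw [h1] at h3
      rw [h2] at h4
      linear_combination -(h3 + h4) / 2
  · rintro ⟨k, hk, h⟩
    have hkn : DifferentiableOn ℂ (fun z => k (-z)) (ball (0 : ℂ) 1) := hk.comp hnegd hneg
    have hmn : ∀ z ∈ ball (0 : ℂ) 1, m (-z) = q (z ^ 2) * k (-z) := by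
      intro z hz
      rw [h (-z) (hneg hz), neg_sq]
    obtain ⟨r, hr, hre⟩ := even_descends (fun z => k z + k (-z)) (hk.add hkn)
      (by intro z _; simp [add_comm])
    set o : ℂ → ℂ := fun z => k z - k (-z) with ho
    have hod : DifferentiableOn ℂ o (ball (0 : ℂ) 1) := hk.sub hkn
    have ho0 : o 0 = 0 := by simp [ho]
    obtain ⟨s, hs, hse⟩ := even_descends (dslope o 0)
      ((Complex.differentiableOn_dslope hnhds).2 hod) (by
        intro z _
        by_cases hz : z = 0
        · simp [hz]
        · rw [dslope_of_ne _ hz, dslope_of_ne _ (neg_ne_zero.2 hz)]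
          simp only [slope_def_field, ho0, ho, neg_neg]
          simp only [neg_zero, sub_self, sub_zero]
          field_simp
          ring)
    have hroot : ∀ w ∈ ball (0 : ℂ) 1, ∃ z ∈ ball (0 : ℂ) 1, z ^ 2 = w := by
      intro w hw
      refine ⟨w ^ ((2 : ℕ) : ℂ)⁻¹, ?_, Complex.cpow_nat_inv_pow w two_ne_zero⟩
      have h2 := Complex.cpow_nat_inv_pow w two_ne_zero
      rw [← h2] at hw
      rw [mem_ball_zero_iff] at hw ⊢
      rw [norm_pow] at hw
      nlinarith [norm_nonneg (w ^ ((2 : ℕ) : ℂ)⁻¹)]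
    have hds : ∀ w ∈ ball (0 : ℂ) 1, w ≠ 0 → d w = q w * s w := by
      intro w hw hw0
      obtain ⟨z, hz, rfl⟩ := hroot w hw
      have hz0 : z ≠ 0 := by rintro rfl; simp at hw0
      have h4 := hdm z hz
      rw [hmn z hz, h z hz] at h4
      have h5 := hse z hz
      rw [dslope_of_ne _ hz0, slope_def_field, ho0, sub_zero, sub_zero] at h5
      rw [h5]
      apply mul_left_cancel₀ hz0
      rw [h4]
      simp only [ho]
      field_simp
    refine ⟨r, s, hr, hs, fun w hw => ⟨?_, ?_⟩⟩
    · obtain ⟨z, hz, rfl⟩ := hroot w hw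
      rw [hbm z hz, hre z hz, hmn z hz, h z hz]
      ring
    · by_cases hw0 : w = 0
      · subst hw0
        have c1 : ContinuousAt d 0 := (hd.differentiableAt hnhds).continuousAt
        have c2 : ContinuousAt (fun w => q w * s w) 0 :=
          ((hq.mul hs).differentiableAt hnhds).continuousAt
        have c1' := c1.tendsto.mono_left (nhdsWithin_le_nhds (s := {(0 : ℂ)}ᶜ))
        have c2' := c2.tendsto.mono_left (nhdsWithin_le_nhds (s := {(0 : ℂ)}ᶜ))
        refine tendsto_nhds_unique_of_eventuallyEq c1' c2' ?_
        filter_upwards [self_mem_nhdsWithin, mem_nhdsWithin_of_mem_nhds hnhds] with x hx hxb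
        exact hds x hxb hx
      · exact hds w hw hw0
end

section
/- There exists a linear operator X on the 4-dimensional complex Hilbert space ℂ⁴ (with the standard inner product) such that: (i) X is irreducible, i.e. the only subspaces M ⊆ ℂ⁴ with X(M) ⊆ M and X*(M) ⊆ M are {0} and ℂ⁴; and (ii) there exist a subspace M ⊆ ℂ⁴ with X(M) ⊆ M and a linear operator Y on ℂ⁴ with XY = YX and Y(M) ⊄ M. In particular, the lattice of invariant subspaces of X differs from its lattice of hyperinvariant subspaces. -/
abbrev E4 := EuclideanSpace ℂ (Fin 4)

noncomputable def XX : E4 →L[ℂ] E4 :=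
  Matrix.toEuclideanCLM (n := Fin 4) (𝕜 := ℂ) !![0,0,1,0; 0,0,0,1; 0,0,0,1; 0,0,0,0]

noncomputable def YY : E4 →L[ℂ] E4 :=
  Matrix.toEuclideanCLM (n := Fin 4) (𝕜 := ℂ) !![0,1,-1,0; 0,0,0,0; 0,0,0,0; 0,0,0,0]

lemma XX_apply (x : E4) : XX x = !₂[x 2, x 3, x 3, 0] := by
  ext i
  fin_cases i <;> simp [XX, Matrix.ofLp_toEuclideanCLM, Matrix.mulVec, dotProduct, Fin.sum_univ_four]

lemma YY_apply (x : E4) : YY x = !₂[x 1 - x 2, 0, 0, 0] := by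
  ext i
  fin_cases i <;> simp [YY, Matrix.ofLp_toEuclideanCLM, Matrix.mulVec, dotProduct, Fin.sum_univ_four, sub_eq_add_neg]

lemma XXadj_apply (x : E4) :
    ContinuousLinearMap.adjoint XX x = !₂[0, 0, x 0, x 1 + x 2] := by
  rw [← ContinuousLinearMap.star_eq_adjoint, XX, ← map_star]
  ext i
  fin_cases i <;> simp [Matrix.ofLp_toEuclideanCLM, Matrix.mulVec, dotProduct, Fin.sum_univ_four,
    Matrix.star_eq_conjTranspose]

/-- There is an irreducible operator on `ℂ⁴` having an invariant subspace that is not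
hyperinvariant. -/
theorem exists_irreducible_with_invariant_not_hyperinvariant :
    ∃ X : EuclideanSpace ℂ (Fin 4) →L[ℂ] EuclideanSpace ℂ (Fin 4),
      (∀ M : Submodule ℂ (EuclideanSpace ℂ (Fin 4)),
        (∀ x ∈ M, X x ∈ M) → (∀ x ∈ M, ContinuousLinearMap.adjoint X x ∈ M) →
        M = ⊥ ∨ M = ⊤) ∧
      (∃ M : Submodule ℂ (EuclideanSpace ℂ (Fin 4)),
        (∀ x ∈ M, X x ∈ M) ∧
        ∃ Y : EuclideanSpace ℂ (Fin 4) →L[ℂ] EuclideanSpace ℂ (Fin 4),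
          X ∘L Y = Y ∘L X ∧ ¬ (∀ x ∈ M, Y x ∈ M)) := by
  refine ⟨XX, ?_, ?_⟩
  · intro M hX hA
    simp only [XX_apply] at hX
    simp only [XXadj_apply] at hA
    by_cases hM : M = ⊥
    · exact Or.inl hM
    right
    obtain ⟨x, hx, hx0⟩ := Submodule.exists_mem_ne_zero_of_ne_bot hM
    have scale : ∀ c : ℂ, c ≠ 0 → (!₂[c, 0, 0, 0] : E4) ∈ M → (!₂[1, 0, 0, 0] : E4) ∈ M := by
      intro c hc h
      have := M.smul_mem c⁻¹ h
      convert this using 1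
      ext i
      fin_cases i <;> simp [hc]
    have h3 : ∀ y ∈ M, y 3 ≠ 0 → (!₂[1, 0, 0, 0] : E4) ∈ M := by
      intro y hy h
      have := hX _ (hX y hy)
      exact scale (y 3) h (by simpa using hX _ (hX y hy))
    have h2 : ∀ y ∈ M, y 2 ≠ 0 → (!₂[1, 0, 0, 0] : E4) ∈ M := by
      intro y hy h
      by_cases h' : y 3 = 0
      · exact scale (y 2) h (by simpa [h'] using hX y hy)
      · exact h3 y hy h'
    have e0 : (!₂[1, 0, 0, 0] : E4) ∈ M := by
      by_cases c3 : x 3 = 0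
      swap
      · exact h3 x hx c3
      by_cases c2 : x 2 = 0
      swap
      · exact h2 x hx c2
      by_cases c0 : x 0 = 0
      swap
      · exact h2 _ (hA x hx) (by simpa using c0)
      by_cases c1 : x 1 = 0
      swap
      · exact h3 _ (hA x hx) (by simpa [c2] using c1)
      exact absurd (by ext i; fin_cases i <;> simp [c0, c1, c2, c3]) hx0
    have e2 : (!₂[0, 0, 1, 0] : E4) ∈ M := by simpa using hA _ e0
    have e3 : (!₂[0, 0, 0, 1] : E4) ∈ M := by simpa using hA _ e2
    have e12 : (!₂[0, 1, 1, 0] : E4) ∈ M := by simpa using hX _ e3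
    rw [eq_top_iff]
    intro z _
    have := M.add_mem (M.add_mem (M.smul_mem (z 0) e0) (M.smul_mem (z 1) e12))
      (M.add_mem (M.smul_mem (z 2 - z 1) e2) (M.smul_mem (z 3) e3))
    convert this using 1
    ext i
    fin_cases i <;> simp
  · refine ⟨Submodule.span ℂ {(!₂[0, 1, 0, 0] : E4)}, ?_, YY, ?_, ?_⟩
    · intro x hx
      obtain ⟨c, rfl⟩ := Submodule.mem_span_singleton.1 hx
      have : XX (c • (!₂[0, 1, 0, 0] : E4)) = 0 := by
        rw [XX_apply]
        ext i
        fin_cases i <;> simp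
      rw [this]
      exact Submodule.zero_mem _
    · ext x i
      simp only [ContinuousLinearMap.comp_apply, XX_apply, YY_apply]
      fin_cases i <;> simp
    · intro h
      have := h _ (Submodule.mem_span_singleton_self _)
      rw [YY_apply] at this
      obtain ⟨c, hc⟩ := Submodule.mem_span_singleton.1 this
      have := congrArg (fun v : E4 => v 0) hc
      simp at this
end

section
/- Let X be a linear operator on the 3-dimensional complex Hilbert space ℂ³ (with the standard inner product). If X is irreducible, i.e. the only subspaces M ⊆ ℂ³ with X(M) ⊆ M and X*(M) ⊆ M are {0} and ℂ³, then every invariant subspace of X is hyperinvariant: for every subspace M with X(M) ⊆ M and every linear operator Y on ℂ³ with XY = YX, one has Y(M) ⊆ M. -/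
theorem aux_rank
    (X : EuclideanSpace ℂ (Fin 3) →L[ℂ] EuclideanSpace ℂ (Fin 3))
    (hirr : ∀ M : Submodule ℂ (EuclideanSpace ℂ (Fin 3)),
      (∀ x ∈ M, X x ∈ M) → (∀ x ∈ M, ContinuousLinearMap.adjoint X x ∈ M) →
      M = ⊥ ∨ M = ⊤) (μ : ℂ) (A : EuclideanSpace ℂ (Fin 3) →ₗ[ℂ] EuclideanSpace ℂ (Fin 3))
    (hA : ∀ x, A x = X x - μ • x) :
    2 ≤ Module.finrank ℂ (LinearMap.range A) := by
  by_contra hlt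
  have h1 := LinearMap.finrank_range_add_finrank_ker A
  have h2 := Submodule.finrank_add_finrank_orthogonal (LinearMap.range A)
  have h3 := Submodule.finrank_sup_add_finrank_inf_eq (LinearMap.ker A) (LinearMap.range A)ᗮ
  have h4 := Submodule.finrank_le (LinearMap.ker A ⊔ (LinearMap.range A)ᗮ)
  have h5 : Module.finrank ℂ (EuclideanSpace ℂ (Fin 3)) = 3 := by simp
  have hX : ∀ x ∈ LinearMap.ker A, X x = μ • x := by
    intro x hx
    rw [LinearMap.mem_ker, hA, sub_eq_zero] at hx
    exact hx
  have hXs : ∀ x ∈ (LinearMap.range A)ᗮ,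
      ContinuousLinearMap.adjoint X x = (starRingEnd ℂ μ) • x := by
    intro x hx
    refine ext_inner_right ℂ fun y => ?_
    have := (Submodule.mem_orthogonal' _ _).1 hx (A y) ⟨y, rfl⟩
    rw [hA, inner_sub_right, sub_eq_zero] at this
    rw [ContinuousLinearMap.adjoint_inner_left, this, inner_smul_right, inner_smul_left]
    simp
  have key : ∀ N : Submodule ℂ (EuclideanSpace ℂ (Fin 3)),
      N ≤ LinearMap.ker A ⊓ (LinearMap.range A)ᗮ → N = ⊥ ∨ N = ⊤ := by
    intro N hN
    apply hirr N
    · intro x hx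
      rw [hX x (hN hx).1]
      exact N.smul_mem _ hx
    · intro x hx
      rw [hXs x (hN hx).2]
      exact N.smul_mem _ hx
  have hne : LinearMap.ker A ⊓ (LinearMap.range A)ᗮ ≠ ⊥ := by
    intro h
    rw [h, finrank_bot] at h3
    omega
  obtain ⟨x, hx, hx0⟩ := Submodule.exists_mem_ne_zero_of_ne_bot hne
  have h6 := finrank_span_singleton (K := ℂ) hx0
  rcases key (ℂ ∙ x) ((Submodule.span_singleton_le_iff_mem _ _).2 hx) with h | h
  · rw [h, finrank_bot] at h6
    omega
  · rw [h, finrank_top] at h6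
    omega

/-- On `ℂ³`, every invariant subspace of an irreducible operator is hyperinvariant. -/
theorem dim_three_irreducible_invariant_is_hyperinvariant
    (X : EuclideanSpace ℂ (Fin 3) →L[ℂ] EuclideanSpace ℂ (Fin 3))
    (hirr : ∀ M : Submodule ℂ (EuclideanSpace ℂ (Fin 3)),
      (∀ x ∈ M, X x ∈ M) → (∀ x ∈ M, ContinuousLinearMap.adjoint X x ∈ M) →
      M = ⊥ ∨ M = ⊤) :
    ∀ M : Submodule ℂ (EuclideanSpace ℂ (Fin 3)), (∀ x ∈ M, X x ∈ M) →
      ∀ Y : EuclideanSpace ℂ (Fin 3) →L[ℂ] EuclideanSpace ℂ (Fin 3),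
        X ∘L Y = Y ∘L X → ∀ x ∈ M, Y x ∈ M := by
  intro M hM Y hXY x hx
  have hc : ∀ z, X (Y z) = Y (X z) := fun z => DFunLike.congr_fun hXY z
  have h5 : Module.finrank ℂ (EuclideanSpace ℂ (Fin 3)) = 3 := by simp
  have hle := Submodule.finrank_le M
  have ho := Submodule.finrank_add_finrank_orthogonal M
  have hAdef : ∀ μ : ℂ, ∃ A : EuclideanSpace ℂ (Fin 3) →ₗ[ℂ] EuclideanSpace ℂ (Fin 3),
      ∀ x, A x = X x - μ • x :=
    fun μ => ⟨(X : EuclideanSpace ℂ (Fin 3) →ₗ[ℂ] EuclideanSpace ℂ (Fin 3)) - μ • LinearMap.id,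
      fun x => by simp⟩
  have hcases : Module.finrank ℂ M = 0 ∨ Module.finrank ℂ M = 1 ∨ Module.finrank ℂ M = 2 ∨
    Module.finrank ℂ M = 3 := by omega
  rcases hcases with h | h | h | h
  · rw [Submodule.finrank_eq_zero] at h
    subst h
    rw [Submodule.mem_bot] at hx
    simp [hx]
  · obtain ⟨⟨v, hv⟩, -, hsp⟩ := finrank_eq_one_iff'.1 h
    obtain ⟨c, hcv⟩ := hsp ⟨X v, hM v hv⟩
    have hcv' : c • v = X v := congrArg Subtype.val hcv
    obtain ⟨A, hA⟩ := hAdef c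
    have hr := aux_rank X hirr c A hA
    have h1 := LinearMap.finrank_range_add_finrank_ker A
    have hMk : M ≤ LinearMap.ker A := by
      intro y hy
      obtain ⟨d, hd⟩ := hsp ⟨y, hy⟩
      have hd' : d • v = y := congrArg Subtype.val hd
      rw [LinearMap.mem_ker, hA, ← hd', map_smul, ← hcv', smul_comm, sub_self]
    have heq : M = LinearMap.ker A := Submodule.eq_of_le_of_finrank_le hMk (by omega)
    rw [heq, LinearMap.mem_ker, hA, sub_eq_zero] at hx ⊢
    rw [hc, hx, map_smul]
  · have h' : Module.finrank ℂ Mᗮ = 1 := by omega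
    obtain ⟨⟨w, hw⟩, -, hsp⟩ := finrank_eq_one_iff'.1 h'
    have hXw : ContinuousLinearMap.adjoint X w ∈ Mᗮ := by
      rw [Submodule.mem_orthogonal']
      intro u hu
      rw [ContinuousLinearMap.adjoint_inner_left]
      exact (Submodule.mem_orthogonal' _ _).1 hw _ (hM u hu)
    obtain ⟨c, hcw⟩ := hsp ⟨_, hXw⟩
    have hcw' : c • w = ContinuousLinearMap.adjoint X w := congrArg Subtype.val hcw
    obtain ⟨A, hA⟩ := hAdef (starRingEnd ℂ c)
    have hr := aux_rank X hirr _ A hA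
    have hMr : LinearMap.range A ≤ M := by
      rintro _ ⟨y, rfl⟩
      rw [← Submodule.orthogonal_orthogonal M, Submodule.mem_orthogonal]
      intro u hu
      obtain ⟨d, hd⟩ := hsp ⟨u, hu⟩
      have hd' : d • w = u := congrArg Subtype.val hd
      rw [← hd', inner_smul_left, hA, inner_sub_right, ← ContinuousLinearMap.adjoint_inner_left,
        ← hcw', inner_smul_left, inner_smul_right, sub_self, mul_zero]
    have heq : LinearMap.range A = M := Submodule.eq_of_le_of_finrank_le hMr (by omega)
    rw [← heq] at hx ⊢
    obtain ⟨y, rfl⟩ := hx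
    exact ⟨Y y, by rw [hA, hA, map_sub, map_smul, hc]⟩
  · have : M = ⊤ := Submodule.eq_top_of_finrank_eq (by omega)
    rw [this]
    trivial
end
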